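/- There is no unitary matrix on ℂ^2 ⊗ ℂ^2 of Schmidt rank exactly 3; i.e., if U is a 4×4 unitary written as U = ∑_{j=1}^{3} A_j ⊗ B_j with A_j, B_j being 2×2 matrices and both families {A_j} and {B_j} linearly independent, then a contradiction follows. -/

import Mathlib

open Matrix Kronecker Finset

theorem not_linearIndependent_pair_of_trace_mul_eq_zero
    {A : Fin 3 → Matrix (Fin 2) (Fin 2) ℂ} (hA : LinearIndependent ℂ A)
    {C : Fin 2 → Matrix (Fin 2) (Fin 2) ℂ} (hC : LinearIndependent ℂ C)
    (h : ∀ i j, (C i * A j).trace = 0) : False := by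
  let e : Matrix (Fin 2) (Fin 2) ℂ ≃ₗ[ℂ] (Fin 2 × Fin 2 → ℂ) :=
    (LinearEquiv.curry ℂ ℂ (Fin 2) (Fin 2)).symm
  let t : Matrix (Fin 2) (Fin 2) ℂ ≃ₗ[ℂ] Matrix (Fin 2) (Fin 2) ℂ :=
    Matrix.transposeLinearEquiv (Fin 2) (Fin 2) ℂ ℂ
  have hA' : LinearIndependent ℂ (Matrix.of fun j => e (A j)).row := hA.map' e.toLinearMap e.ker
  have hC' : LinearIndependent ℂ (Matrix.of fun j => (t.trans e) (C j)).row :=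
    hC.map' (t.trans e).toLinearMap (t.trans e).ker
  have h0 : (Matrix.of fun j => (t.trans e) (C j)) * (Matrix.of fun j => e (A j))ᵀ = 0 := by
    ext i j
    have := h i j
    simp only [Matrix.trace, Matrix.mul_apply, Matrix.diag, Fin.sum_univ_two] at this
    have he (X : Matrix (Fin 2) (Fin 2) ℂ) (k l : Fin 2) : e X (k, l) = X k l := rfl
    have hte (X : Matrix (Fin 2) (Fin 2) ℂ) (k l : Fin 2) : (t.trans e) X (k, l) = X l k := rfl
    simp only [Matrix.mul_apply, Fintype.sum_prod_type, Fin.sum_univ_two, of_apply,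
      transpose_apply, he, hte, Matrix.zero_apply]
    linear_combination this
  have := rank_add_rank_le_card_of_mul_eq_zero h0
  rw [Matrix.rank_transpose, hA'.rank_matrix, hC'.rank_matrix] at this
  simp at this

theorem exists_ne_zero_trace_mul_eq_zero (A : Fin 3 → Matrix (Fin 2) (Fin 2) ℂ) :
    ∃ Y : Matrix (Fin 2) (Fin 2) ℂ, Y ≠ 0 ∧ ∀ j, (Y * A j).trace = 0 := by
  let f : Matrix (Fin 2) (Fin 2) ℂ →ₗ[ℂ] (Fin 3 → ℂ) :=
    LinearMap.pi fun j => Matrix.traceLinearMap (Fin 2) ℂ ℂ ∘ₗ LinearMap.mulRight ℂ (A j)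
  have hf : LinearMap.ker f ≠ ⊥ :=
    LinearMap.ker_ne_bot_of_finrank_lt (by simp [Module.finrank_matrix])
  obtain ⟨Y, hY, hY0⟩ := Submodule.exists_mem_ne_zero_of_ne_bot hf
  exact ⟨Y, hY0, fun j => congrFun (LinearMap.mem_ker.mp hY) j⟩

theorem exists_unitary_mulVec_apply_eq_zero (x y : ℂ) (k : Fin 2) :
    ∃ V ∈ Matrix.unitaryGroup (Fin 2) ℂ, (V *ᵥ ![x, y]) k = 0 := by
  suffices h : ∃ V ∈ Matrix.unitaryGroup (Fin 2) ℂ, (V *ᵥ ![x, y]) 1 = 0 by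
    obtain ⟨V, hV, h1⟩ := h
    match k with
    | 1 => exact ⟨V, hV, h1⟩
    | 0 =>
      refine ⟨!![0, 1; 1, 0] * V, mul_mem ?_ hV, ?_⟩
      · rw [Matrix.mem_unitaryGroup_iff]
        ext i j
        fin_cases i <;> fin_cases j <;> simp [Matrix.mul_apply, Matrix.star_eq_conjTranspose]
      · rw [← Matrix.mulVec_mulVec, Matrix.mulVec, dotProduct]
        simpa using h1
  by_cases h : x = 0 ∧ y = 0
  · exact ⟨1, one_mem _, by simp [h.1, h.2]⟩
  have hn : 0 < ‖x‖ ^ 2 + ‖y‖ ^ 2 := by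
    by_cases hx : x = 0
    · have : y ≠ 0 := fun hy => h ⟨hx, hy⟩
      positivity
    · positivity
  set r : ℝ := √(‖x‖ ^ 2 + ‖y‖ ^ 2) with hr
  have hr0 : (r : ℂ) ≠ 0 := by
    exact_mod_cast (Real.sqrt_pos.mpr hn).ne'
  have hr2 : x * star x + y * star y = (r : ℂ) ^ 2 := by
    have : r ^ 2 = ‖x‖ ^ 2 + ‖y‖ ^ 2 := Real.sq_sqrt hn.le
    simp only [Complex.star_def, Complex.mul_conj, Complex.normSq_eq_norm_sq]
    exact_mod_cast this.symm
  refine ⟨!![star x / r, star y / r; -y / r, x / r], ?_, ?_⟩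
  · rw [Matrix.mem_unitaryGroup_iff]
    ext i j
    simp only [Complex.star_def] at hr2
    fin_cases i <;> fin_cases j <;>
      simp [Matrix.mul_apply, Matrix.star_eq_conjTranspose] <;> field_simp <;>
      first | ring1 | linear_combination hr2
  · simp [Matrix.mulVec, dotProduct]
    ring

theorem exists_unitary_mul_mul_diagonal (S : Matrix (Fin 2) (Fin 2) ℂ) :
    ∃ V ∈ Matrix.unitaryGroup (Fin 2) ℂ, ∃ W ∈ Matrix.unitaryGroup (Fin 2) ℂ,
      (V * S * W) 0 1 = 0 ∧ (V * S * W) 1 0 = 0 := by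
  have hH : (Sᴴ * S).IsHermitian := Matrix.isHermitian_conjTranspose_mul_self S
  obtain ⟨W, hW, hT⟩ : ∃ W ∈ Matrix.unitaryGroup (Fin 2) ℂ, ((S * W)ᴴ * (S * W)) 0 1 = 0 := by
    refine ⟨hH.eigenvectorUnitary, hH.eigenvectorUnitary.2, ?_⟩
    have := hH.conjStarAlgAut_star_eigenvectorUnitary
    rw [Unitary.conjStarAlgAut_star_apply] at this
    rw [Matrix.conjTranspose_mul, ← Matrix.star_eq_conjTranspose]
    simp only [Matrix.mul_assoc] at this ⊢
    rw [this]
    simp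
  set T := S * W with hTdef
  obtain ⟨V, hV, hV0⟩ := exists_unitary_mulVec_apply_eq_zero (T 0 0) (T 1 0) 1
  have hVT : (V * T)ᴴ * (V * T) = Tᴴ * T := by
    rw [Matrix.conjTranspose_mul, Matrix.mul_assoc, ← Matrix.mul_assoc Vᴴ,
      ← Matrix.star_eq_conjTranspose V, Matrix.mem_unitaryGroup_iff'.mp hV, Matrix.one_mul]
  have h10 : (V * T) 1 0 = 0 := by
    simpa [Matrix.mul_apply, Matrix.mulVec, dotProduct] using hV0
  have h01 : star ((V * T) 0 0) * (V * T) 0 1 = 0 := by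
    rw [← hVT, Matrix.mul_apply] at hT
    simpa [h10] using hT
  by_cases h00 : (V * T) 0 0 = 0
  · obtain ⟨V', hV', hV0'⟩ := exists_unitary_mulVec_apply_eq_zero ((V * T) 0 1) ((V * T) 1 1) 0
    refine ⟨V' * V, mul_mem hV' hV, W, hW, ?_, ?_⟩
    · rw [Matrix.mul_assoc, Matrix.mul_assoc, ← hTdef, Matrix.mul_apply]
      simpa [Matrix.mulVec, dotProduct] using hV0'
    · rw [Matrix.mul_assoc, Matrix.mul_assoc, ← hTdef, Matrix.mul_apply]
      simp [h00, h10]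
  · refine ⟨V, hV, W, hW, ?_, ?_⟩
    · rw [Matrix.mul_assoc]
      simpa [h00] using h01
    · rw [Matrix.mul_assoc]
      exact h10

open scoped ComplexOrder in
theorem diagonal_or_dependent_of_blocks {P Q R S : Matrix (Fin 2) (Fin 2) ℂ} {c : ℂ}
    (hc : star c * c = 1) (hP : P = c • S) (h01 : S 0 1 = 0) (h10 : S 1 0 = 0) (hS : S ≠ 0)
    (h₁ : P * Pᴴ + Q * Qᴴ = 1) (h₂ : R * Rᴴ + S * Sᴴ = 1) (h₃ : P * Rᴴ + Q * Sᴴ = 0)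
    (h₄ : Pᴴ * P + Rᴴ * R = 1) (h₅ : Qᴴ * Q + Sᴴ * S = 1) :
    (Q 0 1 = 0 ∧ Q 1 0 = 0 ∧ R 0 1 = 0 ∧ R 1 0 = 0) ∨
      ∃ x y z : ℂ, (x ≠ 0 ∨ y ≠ 0) ∧ x • Q + y • R + z • S = 0 := by
  have hPP : P * Pᴴ = S * Sᴴ := by
    rw [hP, conjTranspose_smul, smul_mul_smul_comm, mul_comm, hc, one_smul]
  have hPP' : Pᴴ * P = Sᴴ * S := by
    rw [hP, conjTranspose_smul, smul_mul_smul_comm, hc, one_smul]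
  have hQ : Q * Qᴴ = 1 - S * Sᴴ := by rw [← h₁, hPP]; abel
  have hQ' : Qᴴ * Q = 1 - Sᴴ * S := by rw [← h₅]; abel
  have hR : R * Rᴴ = 1 - S * Sᴴ := by rw [← h₂]; abel
  have hR' : Rᴴ * R = 1 - Sᴴ * S := by rw [← h₄, hPP']; abel
  have hSe : S = diagonal ![S 0 0, S 1 1] := by
    ext i j
    fin_cases i <;> fin_cases j <;> simp [h01, h10]
  have hnormal : Sᴴ * S = S * Sᴴ := by
    rw [hSe, diagonal_conjTranspose, diagonal_mul_diagonal, diagonal_mul_diagonal]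
    congr 1; ext i; exact mul_comm _ _
  have hcomm {X : Matrix (Fin 2) (Fin 2) ℂ} (hX : X * Xᴴ = 1 - S * Sᴴ)
      (hX' : Xᴴ * X = 1 - Sᴴ * S) : X * (S * Sᴴ) = (S * Sᴴ) * X := by
    have : X * (Xᴴ * X) = X * Xᴴ * X := (Matrix.mul_assoc _ _ _).symm
    rw [hX, hX', hnormal, Matrix.mul_sub, Matrix.sub_mul, Matrix.mul_one, Matrix.one_mul] at this
    exact sub_right_injective this
  have hoff {X : Matrix (Fin 2) (Fin 2) ℂ} (hX : X * (S * Sᴴ) = (S * Sᴴ) * X)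
      (hne : S 0 0 * star (S 0 0) ≠ S 1 1 * star (S 1 1)) : X 0 1 = 0 ∧ X 1 0 = 0 := by
    have e01 := congrFun (congrFun hX 0) 1
    have e10 := congrFun (congrFun hX 1) 0
    simp only [mul_apply, Fin.sum_univ_two, conjTranspose_apply, h01, h10, star_zero] at e01 e10
    constructor
    · refine (mul_eq_zero.mp ?_).resolve_left (sub_ne_zero.mpr hne)
      linear_combination -e01
    · refine (mul_eq_zero.mp ?_).resolve_left (sub_ne_zero.mpr hne)
      linear_combination e10
  by_cases hne : S 0 0 * star (S 0 0) = S 1 1 * star (S 1 1)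
  swap
  · exact Or.inl ⟨(hoff (hcomm hQ hQ') hne).1, (hoff (hcomm hQ hQ') hne).2,
      (hoff (hcomm hR hR') hne).1, (hoff (hcomm hR hR') hne).2⟩
  right
  set s := S 0 0
  set t := S 1 1
  set n := s * star s with hn
  have hn0 : n ≠ 0 := by
    intro h0
    have hs : s = 0 := by simpa [hn] using h0
    have ht : t = 0 := by simpa [h0] using hne.symm
    apply hS
    rw [hSe, hs, ht]
    ext i j
    fin_cases i <;> fin_cases j <;> simp
  have hSS : S * Sᴴ = n • (1 : Matrix (Fin 2) (Fin 2) ℂ) := by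
    ext i j
    fin_cases i <;> fin_cases j <;> simp [mul_apply, h01, h10]
    · rfl
    · exact hne.symm
  have hQQ : Q * Qᴴ = (1 - n) • (1 : Matrix (Fin 2) (Fin 2) ℂ) := by
    rw [hQ, hSS, sub_smul, one_smul]
  have hadj : Q.det • Qᴴ = (1 - n) • Q.adjugate := by
    have := congrArg (Q.adjugate * ·) hQQ
    simpa [← Matrix.mul_assoc, adjugate_mul] using this
  by_cases hD : Q.det = 0
  · have hm : 1 - n = 0 := by
      have := congrArg Matrix.det hQQ
      simpa [hD] using this.symm
    refine ⟨1, 0, 0, by simp, ?_⟩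
    rw [hm, zero_smul, self_mul_conjTranspose_eq_zero] at hQQ
    simp [hQQ]
  refine ⟨-((1 - n) * c * s * t), n * Q.det, (1 - n) * c * (s * Q 1 1 + t * Q 0 0),
    Or.inr (mul_ne_zero hn0 hD), ?_⟩
  have key : (n * Q.det) • R + ((1 - n) * c) • (S * Q.adjugate * S) = 0 := by
    have hRS : star c • (R * Sᴴ) + S * Qᴴ = 0 := by
      have := congrArg conjTranspose h₃
      simpa [hP, conjTranspose_mul] using this
    have hRn : (star c * n) • R + S * Qᴴ * S = 0 := by
      have := congrArg (· * S) hRS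
      simpa [Matrix.add_mul, Matrix.mul_assoc, hnormal, hSS, smul_smul] using this
    have hmul : S * (Q.det • Qᴴ) * S = Q.det • (S * Qᴴ * S) := by simp
    have hadj' : (1 - n) • (S * Q.adjugate * S) = Q.det • (S * Qᴴ * S) := by
      rw [← hmul, hadj]
      simp
    rw [mul_comm (1 - n) c, mul_smul c, hadj', smul_smul, eq_neg_of_add_eq_zero_right hRn,
      smul_neg, smul_smul, show c * Q.det * (star c * n) = star c * c * (n * Q.det) by ring, hc,
      one_mul, add_neg_cancel]
  have hSe' : S = !![s, 0; 0, t] := by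
    ext i j
    fin_cases i <;> fin_cases j <;> simp [h01, h10] <;> rfl
  rw [hSe', adjugate_fin_two] at key
  rw [hSe']
  ext i j
  have k := congrFun (congrFun key i) j
  fin_cases i <;> fin_cases j <;> simp at k ⊢ <;> linear_combination k

theorem LinearIndependent.unitary_mul_mul {A : Fin 3 → Matrix (Fin 2) (Fin 2) ℂ}
    (hA : LinearIndependent ℂ A) {V W : Matrix (Fin 2) (Fin 2) ℂ}
    (hV : V ∈ Matrix.unitaryGroup (Fin 2) ℂ) (hW : W ∈ Matrix.unitaryGroup (Fin 2) ℂ) :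
    LinearIndependent ℂ fun j => V * A j * W := by
  refine hA.map' (LinearMap.mulRight ℂ W ∘ₗ LinearMap.mulLeft ℂ V) (LinearMap.ker_eq_bot.mpr ?_)
  intro X Y hXY
  have h : V * X * W = V * Y * W := hXY
  have h' := congrArg (fun Z => star V * Z * star W) h
  simpa [Matrix.mul_assoc, Matrix.mem_unitaryGroup_iff.mp hW, ← Matrix.mul_assoc (star V),
    Matrix.mem_unitaryGroup_iff'.mp hV] using h'

open scoped ComplexOrder in
theorem false_of_unitary_sum_kronecker_diagonal
    {A B : Fin 3 → Matrix (Fin 2) (Fin 2) ℂ}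
    (hU : ∑ j, A j ⊗ₖ B j ∈ Matrix.unitaryGroup (Fin 2 × Fin 2) ℂ)
    (hA : LinearIndependent ℂ A) (hB : LinearIndependent ℂ B) {a d : ℂ} (had : a ≠ 0 ∨ d ≠ 0)
    (hAd : ∀ j, a * A j 0 0 + d * A j 1 1 = 0)
    (h01 : (∑ j, A j 1 1 • B j) 0 1 = 0) (h10 : (∑ j, A j 1 1 • B j) 1 0 = 0) : False := by
  let T (i k : Fin 2) : Matrix (Fin 2) (Fin 2) ℂ := ∑ j, A j i k • B j
  have hT (i k l m : Fin 2) : (∑ j, A j ⊗ₖ B j) (i, l) (k, m) = T i k l m := by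
    simp [T, Matrix.sum_apply]
  replace h01 : T 1 1 0 1 = 0 := h01
  replace h10 : T 1 1 1 0 = 0 := h10
  have hrow (i i' : Fin 2) :
      T i 0 * (T i' 0)ᴴ + T i 1 * (T i' 1)ᴴ = if i = i' then 1 else 0 := by
    ext l l'
    have := congrFun (congrFun (Matrix.mem_unitaryGroup_iff.mp hU) (i, l)) (i', l')
    rw [Matrix.mul_apply, Fintype.sum_prod_type, Fin.sum_univ_two] at this
    simp only [Matrix.star_apply, hT] at this
    rw [Matrix.add_apply, Matrix.mul_apply, Matrix.mul_apply]
    simp only [Matrix.conjTranspose_apply, this]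
    by_cases h : i = i' <;> simp [h, Matrix.one_apply]
  have hcol (k k' : Fin 2) :
      (T 0 k)ᴴ * T 0 k' + (T 1 k)ᴴ * T 1 k' = if k = k' then 1 else 0 := by
    ext l l'
    have := congrFun (congrFun (Matrix.mem_unitaryGroup_iff'.mp hU) (k, l)) (k', l')
    rw [Matrix.mul_apply, Fintype.sum_prod_type, Fin.sum_univ_two] at this
    simp only [Matrix.star_apply, hT] at this
    rw [Matrix.add_apply, Matrix.mul_apply, Matrix.mul_apply]
    simp only [Matrix.conjTranspose_apply, this]
    by_cases h : k = k' <;> simp [h, Matrix.one_apply]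
  have hrel (w x y z : ℂ) (h : w • T 0 0 + x • T 0 1 + y • T 1 0 + z • T 1 1 = 0) (j : Fin 3) :
      (!![w, y; x, z] * A j).trace = 0 := by
    refine Fintype.linearIndependent_iff.mp hB (fun j => (!![w, y; x, z] * A j).trace) ?_ j
    rw [← h]
    simp only [T, Finset.smul_sum, ← Finset.sum_add_distrib, smul_smul, ← add_smul]
    refine Finset.sum_congr rfl fun j _ => ?_
    congr 1
    simp [Matrix.trace, Matrix.vecMul, dotProduct]
    ring
  have haT : a • T 0 0 + d • T 1 1 = 0 := by
    simp only [T, Finset.smul_sum, ← Finset.sum_add_distrib, smul_smul, ← add_smul, hAd, zero_smul,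
      Finset.sum_const_zero]
  have htr : ((T 0 0)ᴴ * T 0 0).trace = ((T 1 1)ᴴ * T 1 1).trace := by
    have e₁ := congrArg Matrix.trace (hcol 0 0)
    have e₂ := congrArg Matrix.trace (hrow 1 1)
    simp only [Matrix.trace_add, if_true] at e₁ e₂
    rw [Matrix.trace_mul_comm (T 1 0), Matrix.trace_mul_comm (T 1 1)] at e₂
    linear_combination e₁ - e₂
  by_cases hS : T 1 1 = 0
  · have hP : T 0 0 = 0 := by
      rw [hS, Matrix.mul_zero, Matrix.trace_zero] at htr
      exact Matrix.trace_conjTranspose_mul_self_eq_zero_iff.mp htr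
    refine not_linearIndependent_pair_of_trace_mul_eq_zero hA
      (C := ![!![1, 0; 0, 0], !![0, 0; 0, 1]]) ?_ ?_
    · rw [LinearIndependent.pair_iff]
      intro s t h
      have e₀ := congrFun (congrFun h 0) 0
      have e₁ := congrFun (congrFun h 1) 1
      simp at e₀ e₁
      exact ⟨e₀, e₁⟩
    · intro i
      fin_cases i
      · exact hrel 1 0 0 0 (by simp [hP])
      · exact hrel 0 0 0 1 (by simp [hS])
  have ha : a ≠ 0 := by
    rintro rfl
    rw [zero_smul, zero_add] at haT
    exact (smul_eq_zero.mp haT).elim (had.resolve_left (by simp)) hS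
  have hP : T 0 0 = (-d / a) • T 1 1 := by
    rw [div_eq_inv_mul, mul_smul, neg_smul, ← eq_neg_of_add_eq_zero_left haT, smul_smul,
      inv_mul_cancel₀ ha, one_smul]
  have hc : star (-d / a) * (-d / a) = 1 := by
    rw [hP, Matrix.conjTranspose_smul, smul_mul_smul_comm, Matrix.trace_smul, smul_eq_mul] at htr
    exact mul_right_cancel₀ (mt Matrix.trace_conjTranspose_mul_self_eq_zero_iff.mp hS)
      (htr.trans (one_mul _).symm)
  rcases diagonal_or_dependent_of_blocks hc hP h01 h10 hS (hrow 0 0) (hrow 1 1) (hrow 0 1)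
    (hcol 0 0) (hcol 1 1) with ⟨hQ01, hQ10, hR01, hR10⟩ | ⟨x, y, z, hxy, h⟩
  · have hzero (l m : Fin 2) (h : ∀ i k, T i k l m = 0) (j : Fin 3) : B j l m = 0 := by
      refine Fintype.linearIndependent_iff.mp hA (fun j => B j l m) ?_ j
      ext i k
      have := h i k
      simpa [T, Matrix.sum_apply, mul_comm] using this
    have hB01 := hzero 0 1 fun i k => by
      fin_cases i <;> fin_cases k
      · simpa [h01] using congrFun (congrFun hP 0) 1
      · exact hQ01
      · exact hR01
      · exact h01
    have hB10 := hzero 1 0 fun i k => by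
      fin_cases i <;> fin_cases k
      · simpa [h10] using congrFun (congrFun hP 1) 0
      · exact hQ10
      · exact hR10
      · exact h10
    refine not_linearIndependent_pair_of_trace_mul_eq_zero hB
      (C := ![!![0, 1; 0, 0], !![0, 0; 1, 0]]) ?_ ?_
    · rw [LinearIndependent.pair_iff]
      intro s t h
      have e₀ := congrFun (congrFun h 0) 1
      have e₁ := congrFun (congrFun h 1) 0
      simp at e₀ e₁
      exact ⟨e₀, e₁⟩
    · intro i j
      fin_cases i <;> simp [Matrix.trace, Matrix.vecMul, dotProduct, hB01, hB10]
  · refine not_linearIndependent_pair_of_trace_mul_eq_zero hA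
      (C := ![!![a, 0; 0, d], !![0, y; x, z]]) ?_ ?_
    · rw [LinearIndependent.pair_iff]
      intro s t h
      have e₀ := congrFun (congrFun h 0) 0
      have e₁ := congrFun (congrFun h 0) 1
      have e₂ := congrFun (congrFun h 1) 0
      simp [ha] at e₀ e₁ e₂
      exact ⟨e₀, hxy.elim e₂.resolve_right e₁.resolve_right⟩
    · intro i
      fin_cases i
      · exact hrel a 0 0 d (by simpa using haT)
      · exact hrel 0 x y z (by simpa using h)

theorem stmt_1 (U : Matrix (Fin 2 × Fin 2) (Fin 2 × Fin 2) ℂ)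
    (hU : U ∈ Matrix.unitaryGroup (Fin 2 × Fin 2) ℂ)
    (A B : Fin 3 → Matrix (Fin 2) (Fin 2) ℂ)
    (hA : LinearIndependent ℂ A) (hB : LinearIndependent ℂ B)
    (hexp : U = ∑ j, A j ⊗ₖ B j) : False := by
  obtain ⟨Y, hY0, hY⟩ := exists_ne_zero_trace_mul_eq_zero A
  obtain ⟨V, hV, W, hW, hD01, hD10⟩ := exists_unitary_mul_mul_diagonal Y
  set D := V * Y * W with hD
  have hVV := Matrix.mem_unitaryGroup_iff'.mp hV
  have hWW := Matrix.mem_unitaryGroup_iff.mp hW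
  have hsV := Unitary.star_mem hV
  have hsW := Unitary.star_mem hW
  let A' (j : Fin 3) := star W * A j * star V
  have hDA (j : Fin 3) : D 0 0 * A' j 0 0 + D 1 1 * A' j 1 1 = 0 := by
    have h : (D * A' j).trace = 0 := by
      have e : D * A' j = V * (Y * A j * star V) := by
        simp only [hD, A', Matrix.mul_assoc]
        rw [← Matrix.mul_assoc W, hWW, Matrix.one_mul]
      rw [e, Matrix.trace_mul_comm, Matrix.mul_assoc, hVV, Matrix.mul_one, hY]
    simpa [Matrix.trace, Matrix.mul_apply, hD01, hD10] using h
  have hD0 : D 0 0 ≠ 0 ∨ D 1 1 ≠ 0 := by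
    by_contra! h
    have hDz : D = 0 := by
      ext i k
      fin_cases i <;> fin_cases k <;> simp [h, hD01, hD10]
    apply hY0
    have := congrArg (fun Z => star V * Z * star W) hDz
    simpa [hD, Matrix.mul_assoc, hWW, ← Matrix.mul_assoc (star V), hVV] using this
  obtain ⟨V', hV', W', hW', h01, h10⟩ := exists_unitary_mul_mul_diagonal (∑ j, A' j 1 1 • B j)
  have hS : V' * (∑ j, A' j 1 1 • B j) * W' = ∑ j, A' j 1 1 • (V' * B j * W') := by
    simp [Matrix.mul_sum, Matrix.sum_mul]
  rw [hS] at h01 h10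
  refine false_of_unitary_sum_kronecker_diagonal (A := A') (B := fun j => V' * B j * W') ?_
    (hA.unitary_mul_mul hsW hsV) (hB.unitary_mul_mul hV' hW') hD0 hDA h01 h10
  have hU' : (star W ⊗ₖ V') * U * (star V ⊗ₖ W') = ∑ j, A' j ⊗ₖ (V' * B j * W') := by
    simp [hexp, A', Matrix.mul_sum, Matrix.sum_mul, Matrix.mul_kronecker_mul]
  rw [← hU']
  exact mul_mem (mul_mem (Matrix.kronecker_mem_unitary hsW hV') hU)
    (Matrix.kronecker_mem_unitary hsV hW')
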